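/- arXiv:math/9806124 — 4 statements merged into one kernel-verified Lean document; each statement's English description precedes it below -/
import Mathlib

section
/- Suppose K is of type D with constant m or of type E with constant m. Let α ∈ K(ε_2)*, let c = N(α) ∈ K*, and suppose α^2 = c·ε_m. Then K is of type D (the case of type E is impossible), so ε_m + ε_m^{−1} ∈ K, and c = (ε_m + ε_m^{−1} + 2)·c_1^2 for some c_1 ∈ K*. -/
noncomputable section

/-- `x ∈ K̄` lies in (the image of) the base field `K`. -/
def InK (K : Type*) [Field K] (x : AlgebraicClosure K) : Prop :=
  x ∈ Set.range (algebraMap K (AlgebraicClosure K))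

/-- Type A: `ε₂ ∈ K` and `εₙ ∈ K` for every `n`. -/
def TypeA (K : Type*) [Field K] (ε : ℕ → AlgebraicClosure K) : Prop :=
  InK K (ε 2) ∧ ∀ n : ℕ, InK K (ε n)

/-- Type B: `ε₂ ∈ K` and there is a unique `m ≥ 2` with `ε_m ∈ K`, `ε_{m+1} ∉ K`. -/
def TypeB (K : Type*) [Field K] (ε : ℕ → AlgebraicClosure K) : Prop :=
  InK K (ε 2) ∧ ∃! m : ℕ, 2 ≤ m ∧ InK K (ε m) ∧ ¬InK K (ε (m + 1))

/-- Type C: `ε₂ ∉ K` and `εₙ + εₙ⁻¹ ∈ K` for every `n`. -/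
def TypeC (K : Type*) [Field K] (ε : ℕ → AlgebraicClosure K) : Prop :=
  ¬InK K (ε 2) ∧ ∀ n : ℕ, InK K (ε n + (ε n)⁻¹)

/-- Type D: `ε₂ ∉ K` and there is a unique `m ≥ 2` with `ε_m + ε_m⁻¹ ∈ K`,
`ε_{m+1} + ε_{m+1}⁻¹ ∉ K` and `ε_{m+1} - ε_{m+1}⁻¹ ∉ K`. -/
def TypeD (K : Type*) [Field K] (ε : ℕ → AlgebraicClosure K) : Prop :=
  ¬InK K (ε 2) ∧ ∃! m : ℕ, 2 ≤ m ∧ InK K (ε m + (ε m)⁻¹) ∧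
    ¬InK K (ε (m + 1) + (ε (m + 1))⁻¹) ∧ ¬InK K (ε (m + 1) - (ε (m + 1))⁻¹)

/-- Type E: `ε₂ ∉ K` and there is a unique `m ≥ 3` with `ε_m - ε_m⁻¹ ∈ K`. -/
def TypeE (K : Type*) [Field K] (ε : ℕ → AlgebraicClosure K) : Prop :=
  ¬InK K (ε 2) ∧ ∃! m : ℕ, 3 ≤ m ∧ InK K (ε m - (ε m)⁻¹)

/-- Type B with constant `m`. -/
def TypeBc (K : Type*) [Field K] (ε : ℕ → AlgebraicClosure K) (m : ℕ) : Prop :=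
  InK K (ε 2) ∧ 2 ≤ m ∧ InK K (ε m) ∧ ¬InK K (ε (m + 1))

/-- Type D with constant `m`. -/
def TypeDc (K : Type*) [Field K] (ε : ℕ → AlgebraicClosure K) (m : ℕ) : Prop :=
  ¬InK K (ε 2) ∧ 2 ≤ m ∧ InK K (ε m + (ε m)⁻¹) ∧
    ¬InK K (ε (m + 1) + (ε (m + 1))⁻¹) ∧ ¬InK K (ε (m + 1) - (ε (m + 1))⁻¹)

/-- Type E with constant `m`. -/
def TypeEc (K : Type*) [Field K] (ε : ℕ → AlgebraicClosure K) (m : ℕ) : Prop :=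
  ¬InK K (ε 2) ∧ 3 ≤ m ∧ InK K (ε m - (ε m)⁻¹)

/-- `a ∈ K_s = K* ∩ (K(ε₂)*)^{2^s}`: `a = α^{2^s}` for some `α ∈ K(ε₂)*`. -/
def MemKs (K : Type*) [Field K] (ε : ℕ → AlgebraicClosure K) (s : ℕ) (a : K) : Prop :=
  ∃ α : AlgebraicClosure K, α ∈ IntermediateField.adjoin K {ε 2} ∧ α ≠ 0 ∧
    algebraMap K (AlgebraicClosure K) a = α ^ 2 ^ s

/-- A minimal idempotent of a commutative ring: a nonzero idempotent which is not
the sum of two nonzero orthogonal idempotents. -/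
def IsMinIdem {A : Type*} [CommRing A] (e : A) : Prop :=
  e ≠ 0 ∧ e * e = e ∧
    ¬∃ e₁ e₂ : A, e₁ ≠ 0 ∧ e₂ ≠ 0 ∧ e₁ * e₁ = e₁ ∧ e₂ * e₂ = e₂ ∧
      e₁ * e₂ = 0 ∧ e = e₁ + e₂

/-- If `i² = -1`, every element of `K(i)` has the form `a + b i` with `a, b ∈ K`. -/
theorem exists_eq_add_mul_of_mem_adjoin {K L : Type*} [Field K] [Field L] [Algebra K L]
    {i : L} (hi : i ^ 2 = -1) {x : L} (hx : x ∈ IntermediateField.adjoin K {i}) :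
    ∃ a b : K, x = algebraMap K L a + algebraMap K L b * i := by
  have hint : IsIntegral K i :=
    ⟨Polynomial.X ^ 2 + 1, by monicity!, by simp [hi]⟩
  rw [← IntermediateField.mem_toSubalgebra,
    IntermediateField.adjoin_simple_toSubalgebra_of_isAlgebraic hint.isAlgebraic] at hx
  induction hx using Algebra.adjoin_induction with
  | mem x hx => exact ⟨0, 1, by simp_all⟩
  | algebraMap r => exact ⟨r, 0, by simp⟩
  | add x y _ _ hx hy =>
    obtain ⟨a, b, rfl⟩ := hx
    obtain ⟨c, d, rfl⟩ := hy
    exact ⟨a + c, b + d, by simp only [map_add]; ring⟩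
  | mul x y _ _ hx hy =>
    obtain ⟨a, b, rfl⟩ := hx
    obtain ⟨c, d, rfl⟩ := hy
    refine ⟨a * c - b * d, a * d + b * c, ?_⟩
    simp only [map_add, map_sub, map_mul]
    linear_combination algebraMap K L b * algebraMap K L d * hi

/-- If `i² = -1`, an element of `K(i)` fixed by a nontrivial `K`-automorphism lies in `K`. -/
theorem exists_algebraMap_eq_of_fixed {K L : Type*} [Field K] [Field L] [Algebra K L]
    {i : L} (hi : i ^ 2 = -1)
    (σ : IntermediateField.adjoin K {i} ≃ₐ[K] IntermediateField.adjoin K {i})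
    (hσ : σ ≠ AlgEquiv.refl) {x : IntermediateField.adjoin K {i}} (hx : σ x = x) :
    ∃ a : K, algebraMap K (IntermediateField.adjoin K {i}) a = x := by
  let j := IntermediateField.AdjoinSimple.gen K i
  have repr (y : IntermediateField.adjoin K {i}) :
      ∃ a b : K, y = algebraMap K _ a + algebraMap K _ b * j := by
    obtain ⟨a, b, h⟩ := exists_eq_add_mul_of_mem_adjoin hi y.2
    exact ⟨a, b, Subtype.ext h⟩
  have hj : σ j ≠ j := fun hj => hσ <| AlgEquiv.ext fun y => by
    obtain ⟨a, b, rfl⟩ := repr y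
    simp [hj]
  obtain ⟨a, b, rfl⟩ := repr x
  simp only [map_add, map_mul, AlgEquiv.commutes, add_right_inj, mul_eq_mul_left_iff, hj,
    false_or] at hx
  exact ⟨a, by simp [hx]⟩

/-- Lemma 2, case 4): `t = m`.  If `K` is of type D or E with constant `m`,
`α ∈ K(ε₂)*`, `c = N(α) ∈ K*` and `α² = c·ε_m`, then `K` is of type D,
`ε_m + ε_m⁻¹ ∈ K` and `c ∈ (ε_m + ε_m⁻¹ + 2)·K*²`. -/
theorem stmt_6 (K : Type*) [Field K] (h2 : (2 : K) ≠ 0)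
    (ε : ℕ → AlgebraicClosure K)
    (hprim : ∀ n : ℕ, IsPrimitiveRoot (ε n) (2 ^ n))
    (hcomp : ∀ n : ℕ, ε (n + 1) ^ 2 = ε n)
    (m : ℕ) (hDE : TypeDc K ε m ∨ TypeEc K ε m)
    (σ : (IntermediateField.adjoin K {ε 2}) ≃ₐ[K] (IntermediateField.adjoin K {ε 2}))
    (hσ : σ ≠ AlgEquiv.refl)
    (α : IntermediateField.adjoin K {ε 2}) (hα : α ≠ 0)
    (c : K) (hc : algebraMap K (IntermediateField.adjoin K {ε 2}) c = α * σ α)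
    (ht : (α : AlgebraicClosure K) ^ 2 = algebraMap K (AlgebraicClosure K) c * ε m) :
    TypeDc K ε m ∧
    ∃ w : K, algebraMap K (AlgebraicClosure K) w = ε m + (ε m)⁻¹ ∧
      ∃ c₁ : K, c₁ ≠ 0 ∧ c = (w + 2) * c₁ ^ 2 := by
  have hi : ε 2 ^ 2 = -1 := by
    rw [hcomp 1]
    exact IsPrimitiveRoot.eq_neg_one_of_two_right (by simpa using hprim 1)
  have hm : 2 ≤ m := hDE.elim (fun h => h.2.1) fun h => by have := h.2.1; omega
  have he_sq : ε m ^ 2 ≠ 1 :=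
    (hprim m).pow_ne_one_of_pos_of_lt two_ne_zero
      (lt_of_lt_of_le (by norm_num) (Nat.pow_le_pow_right two_pos hm))
  have hσα : σ α ≠ 0 := by simpa using hα
  obtain ⟨e, he⟩ : ∃ e : IntermediateField.adjoin K {ε 2},
      (e : AlgebraicClosure K) = ε m ∧ α = σ α * e := by
    have hα' : (α : AlgebraicClosure K) ≠ 0 := by simpa using hα
    have hσα' : (σ α : AlgebraicClosure K) ≠ 0 := by simpa using hσα
    have hc' : algebraMap K (AlgebraicClosure K) c = α * (σ α : AlgebraicClosure K) :=
      congrArg Subtype.val hc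
    refine ⟨α / σ α, ?_, by field_simp⟩
    rw [hc'] at ht
    push_cast
    rw [div_eq_iff hσα']
    exact mul_left_cancel₀ hα' (by linear_combination ht)
  obtain ⟨he, hαe⟩ := he
  have hσσ : σ (σ α) = α := by
    have h := congrArg σ hc
    rw [AlgEquiv.commutes, hc, map_mul, mul_comm] at h
    exact (mul_left_cancel₀ hσα h).symm
  have hnorm : e * σ e = 1 := by
    have h := congrArg σ hαe
    rw [map_mul, hσσ] at h
    refine mul_left_cancel₀ hα ?_
    linear_combination -e * h - hαe
  have he0 : e ≠ 0 := left_ne_zero_of_mul_eq_one hnorm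
  have hσe : σ e = e⁻¹ := eq_inv_of_mul_eq_one_right hnorm
  have he1 : e ^ 2 ≠ 1 := fun h => he_sq <| by
    rw [← he]; exact_mod_cast congrArg Subtype.val h
  have h1e : 1 + e ≠ 0 := fun h => he1 <| by linear_combination (e - 1) * h
  refine ⟨hDE.resolve_right ?_, ?_⟩
  · rintro ⟨-, -, r, hr⟩
    have hr' : algebraMap K (IntermediateField.adjoin K {ε 2}) r = e - e⁻¹ :=
      Subtype.ext (by push_cast; rw [he]; exact hr)
    have h := congrArg σ hr'
    rw [AlgEquiv.commutes, hr', map_sub, map_inv₀, hσe, inv_inv] at h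
    have h2' : (2 : IntermediateField.adjoin K {ε 2}) ≠ 0 := by
      rw [← map_ofNat (algebraMap K (IntermediateField.adjoin K {ε 2})) 2]
      exact (map_ne_zero _).2 h2
    field_simp at h
    exact he1 (mul_left_cancel₀ h2' (by linear_combination h))
  · obtain ⟨w, hw⟩ := exists_algebraMap_eq_of_fixed hi σ hσ
      (x := e + e⁻¹) (by rw [map_add, map_inv₀, hσe, inv_inv, add_comm])
    obtain ⟨d, hd⟩ := exists_algebraMap_eq_of_fixed hi σ hσ (x := α / (1 + e)) (by
      have h1e' : 1 + e⁻¹ ≠ 0 := by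
        simpa [hσe] using (map_ne_zero σ).2 h1e
      rw [map_div₀, map_add, map_one, hσe, div_eq_div_iff h1e' h1e]
      nth_rewrite 2 [hαe]
      field_simp
      ring)
    refine ⟨w, ?_, d, ?_, ?_⟩
    · rw [← he]; exact congrArg Subtype.val hw
    · rintro rfl
      rw [map_zero, eq_comm, div_eq_zero_iff] at hd
      exact hd.elim hα h1e
    · apply (algebraMap K (IntermediateField.adjoin K {ε 2})).injective
      have hσα' : σ α = α / e := by rw [eq_div_iff he0]; exact hαe.symm
      rw [hc, map_mul, map_add, map_pow, hw, hd, map_ofNat, hσα']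
      field_simp
      ring
end
end

section
/- Suppose K is of type C and let s ≥ 1 be a natural number. Then K_s = ⟨−1⟩ × K*^{2^s}, i.e. an element a ∈ K* satisfies a = α^{2^s} for some α ∈ K(ε_2)* if and only if a = b^{2^s} or a = −b^{2^s} for some b ∈ K*. -/
noncomputable section

theorem mem_adjoin_simple_of_sq_eq_neg_one {K L : Type*} [Field K] [Field L] [Algebra K L]
    {i : L} (hi : i ^ 2 = -1) {z : L} (hz : z ∈ IntermediateField.adjoin K {i}) :
    ∃ x y : K, z = algebraMap K L x + algebraMap K L y * i := by
  have hint : IsIntegral K i := by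
    refine IsIntegral.of_pow (n := 2) (by norm_num) ?_
    rw [hi]
    exact isIntegral_one.neg
  rw [← IntermediateField.mem_toSubalgebra,
    IntermediateField.adjoin_simple_toSubalgebra_of_isAlgebraic hint.isAlgebraic] at hz
  induction hz using Algebra.adjoin_induction with
  | mem w hw =>
    rw [Set.mem_singleton_iff] at hw
    exact ⟨0, 1, by simp [hw]⟩
  | algebraMap r => exact ⟨r, 0, by simp⟩
  | add w₁ w₂ _ _ h₁ h₂ =>
    obtain ⟨x₁, y₁, rfl⟩ := h₁
    obtain ⟨x₂, y₂, rfl⟩ := h₂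
    exact ⟨x₁ + x₂, y₁ + y₂, by simp only [map_add]; ring⟩
  | mul w₁ w₂ _ _ h₁ h₂ =>
    obtain ⟨x₁, y₁, rfl⟩ := h₁
    obtain ⟨x₂, y₂, rfl⟩ := h₂
    refine ⟨x₁ * x₂ - y₁ * y₂, x₁ * y₂ + y₁ * x₂, ?_⟩
    simp only [map_add, map_sub, map_mul]
    linear_combination algebraMap K L y₁ * algebraMap K L y₂ * hi

/-- An element of `K(i)` with square in `K` is an element of `K`, possibly times `i`. -/
theorem eq_or_eq_mul_of_sq_mem_range {K L : Type*} [Field K] [Field L] [Algebra K L]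
    (h2 : (2 : K) ≠ 0) {i : L} (hi : i ^ 2 = -1) (hiK : i ∉ Set.range (algebraMap K L))
    {z : L} (hz : z ∈ IntermediateField.adjoin K {i}) {c : K} (hc : z ^ 2 = algebraMap K L c) :
    ∃ x : K, z = algebraMap K L x ∨ z = algebraMap K L x * i := by
  obtain ⟨x, y, rfl⟩ := mem_adjoin_simple_of_sq_eq_neg_one hi hz
  rcases eq_or_ne x 0 with rfl | hx
  · exact ⟨y, Or.inr (by simp)⟩
  rcases eq_or_ne y 0 with rfl | hy
  · exact ⟨x, Or.inl (by simp)⟩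
  refine absurd ⟨(c - x ^ 2 + y ^ 2) / (2 * x * y), ?_⟩ hiK
  have hd : algebraMap K L (2 * x * y) ≠ 0 := by
    rw [Ne, map_eq_zero]
    exact mul_ne_zero (mul_ne_zero h2 hx) hy
  rw [map_div₀, div_eq_iff hd]
  simp only [map_add, map_sub, map_mul, map_pow, map_ofNat]
  linear_combination algebraMap K L y ^ 2 * hi - hc

section TwoPowerRoots

variable {L : Type*} [Field L] {ε : ℕ → L}

theorem root_one_eq_neg_one (hprim : ∀ n, IsPrimitiveRoot (ε n) (2 ^ n)) : ε 1 = -1 :=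
  IsPrimitiveRoot.eq_neg_one_of_two_right (by simpa using hprim 1)

theorem root_add_pow (hcomp : ∀ n, ε (n + 1) ^ 2 = ε n) (n k : ℕ) :
    ε (n + k) ^ 2 ^ k = ε n := by
  induction k with
  | zero => simp
  | succ k ih => rw [← add_assoc, pow_succ', pow_mul, hcomp, ih]

theorem root_mem_adjoin {K : Type*} [Field K] [Algebra K L]
    (hprim : ∀ n, IsPrimitiveRoot (ε n) (2 ^ n)) (hcomp : ∀ n, ε (n + 1) ^ 2 = ε n)
    (hK : ∀ n, ε n + (ε n)⁻¹ ∈ Set.range (algebraMap K L)) (n : ℕ) :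
    ε n ∈ IntermediateField.adjoin K {ε 2} := by
  have hmem : ε 2 ∈ IntermediateField.adjoin K {ε 2} :=
    IntermediateField.mem_adjoin_simple_self K _
  induction n with
  | zero =>
    rw [← root_add_pow hcomp 0 2]
    exact pow_mem hmem _
  | succ n ih =>
    have hne : ε (n + 1) ≠ 0 := (hprim (n + 1)).ne_zero (by simp)
    have key : ε (n + 1) * (ε (n + 1) + (ε (n + 1))⁻¹) = ε n + 1 := by
      rw [mul_add, mul_inv_cancel₀ hne, ← hcomp n]
      ring
    by_cases ht : ε (n + 1) + (ε (n + 1))⁻¹ = 0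
    · have hn : ε n = ε 1 := by
        rw [root_one_eq_neg_one hprim]
        rw [ht, mul_zero] at key
        linear_combination -key
      have h1 : n = 1 := by
        have h := (hprim n).eq_orderOf
        rw [hn, ← (hprim 1).eq_orderOf] at h
        exact Nat.pow_right_injective le_rfl h
      rwa [h1]
    · rw [eq_div_of_mul_eq ht key]
      obtain ⟨t, ht'⟩ := hK (n + 1)
      rw [← ht']
      exact div_mem (add_mem ih (one_mem _)) (IntermediateField.algebraMap_mem _ t)

theorem exists_eq_mul_root_pow {K : Type*} [Field K] [Algebra K L] (h2 : (2 : K) ≠ 0)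
    (hprim : ∀ n, IsPrimitiveRoot (ε n) (2 ^ n)) (hcomp : ∀ n, ε (n + 1) ^ 2 = ε n)
    (hεK : ε 2 ∉ Set.range (algebraMap K L))
    (hK : ∀ n, ε n + (ε n)⁻¹ ∈ Set.range (algebraMap K L)) (s : ℕ) {α : L}
    (hα : α ∈ IntermediateField.adjoin K {ε 2})
    (hαs : α ^ 2 ^ s ∈ Set.range (algebraMap K L)) :
    ∃ (c : K) (j : ℕ), α = algebraMap K L c * ε (s + 1) ^ j := by
  induction s generalizing α with
  | zero =>
    obtain ⟨c, hc⟩ := hαs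
    exact ⟨c, 0, by simpa using hc.symm⟩
  | succ s ih =>
    obtain ⟨c, j, hc⟩ := ih (pow_mem hα 2) (by rwa [← pow_mul, ← pow_succ'])
    have hne : ε (s + 2) ^ j ≠ 0 := pow_ne_zero _ ((hprim (s + 2)).ne_zero (by simp))
    have hsq : (α / ε (s + 2) ^ j) ^ 2 = algebraMap K L c := by
      rw [div_pow, div_eq_iff (pow_ne_zero _ hne), hc, ← pow_mul, mul_comm j, pow_mul,
        hcomp (s + 1)]
    have hi : ε 2 ^ 2 = -1 := (hcomp 1).trans (root_one_eq_neg_one hprim)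
    obtain ⟨x, hx | hx⟩ := eq_or_eq_mul_of_sq_mem_range h2 hi hεK
      (div_mem hα (pow_mem (root_mem_adjoin hprim hcomp hK (s + 2)) j)) hsq
    · exact ⟨x, j, (div_eq_iff hne).1 hx⟩
    · refine ⟨x, 2 ^ s + j, ?_⟩
      rw [(div_eq_iff hne).1 hx, pow_add, add_right_comm, add_assoc, add_comm s 2,
        root_add_pow hcomp, add_comm 2 s, mul_assoc]

end TwoPowerRoots

/-- Lemma 3, case 2): if `K` is of type C and `s ≥ 1`, then
`K_s = ⟨-1⟩ × K*^{2^s}`. -/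
theorem stmt_7 (K : Type*) [Field K] (h2 : (2 : K) ≠ 0)
    (ε : ℕ → AlgebraicClosure K)
    (hprim : ∀ n : ℕ, IsPrimitiveRoot (ε n) (2 ^ n))
    (hcomp : ∀ n : ℕ, ε (n + 1) ^ 2 = ε n)
    (hC : TypeC K ε) (s : ℕ) (hs : 1 ≤ s) :
    ∀ a : K, a ≠ 0 →
      (MemKs K ε s a ↔ ∃ b : K, b ≠ 0 ∧ (a = b ^ 2 ^ s ∨ a = -b ^ 2 ^ s)) := by
  intro a ha
  have h1 : ε 1 = -1 := root_one_eq_neg_one hprim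
  have hroot : ε (s + 1) ^ 2 ^ s = -1 := by
    rw [add_comm, root_add_pow hcomp, h1]
  constructor
  · rintro ⟨α, hα, hα0, haα⟩
    obtain ⟨c, j, rfl⟩ := exists_eq_mul_root_pow h2 hprim hcomp hC.1 hC.2 s hα ⟨a, haα⟩
    have hc : c ≠ 0 := by
      rintro rfl
      simp at hα0
    refine ⟨c, hc, ?_⟩
    rw [mul_pow, ← pow_mul, mul_comm j, pow_mul, hroot] at haα
    refine (neg_one_pow_eq_or (AlgebraicClosure K) j).imp (fun hj => ?_) (fun hj => ?_) <;>
      · apply FaithfulSMul.algebraMap_injective K (AlgebraicClosure K)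
        simp [haα, hj]
  · rintro ⟨b, hb, rfl | rfl⟩
    · exact ⟨algebraMap K _ b, IntermediateField.algebraMap_mem _ b, by simpa using hb, by simp⟩
    · refine ⟨algebraMap K _ b * ε (s + 1), mul_mem (IntermediateField.algebraMap_mem _ b)
        (root_mem_adjoin hprim hcomp hC.2 (s + 1)), mul_ne_zero (by simpa using hb)
        ((hprim (s + 1)).ne_zero (by simp)), ?_⟩
      rw [mul_pow, hroot]
      simp
end
end

section
/- Suppose K is of type E with constant m and let s ≥ m be a natural number. Then K_s = K*^{2^s}, i.e. an element a ∈ K* satisfies a = α^{2^s} for some α ∈ K(ε_2)* if and only if a = b^{2^s} for some b ∈ K*. -/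
noncomputable section

open IntermediateField (adjoin mem_toSubalgebra mem_adjoin_simple_self
  adjoin_simple_toSubalgebra_of_isAlgebraic)

section

variable {K : Type*} [Field K]

/-- Elements of `K(i)` with `i ^ 2 = -1` are of the form `x + y i`. -/
theorem exists_add_mul_of_mem_adjoin {i α : AlgebraicClosure K} (hi : i ^ 2 = -1)
    (hα : α ∈ adjoin K {i}) :
    ∃ x y : K, α = algebraMap K _ x + algebraMap K _ y * i := by
  rw [← mem_toSubalgebra, adjoin_simple_toSubalgebra_of_isAlgebraic
    (Algebra.IsAlgebraic.isAlgebraic i)] at hα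
  induction hα using Algebra.adjoin_induction with
  | mem x hx => exact ⟨0, 1, by simpa using hx⟩
  | algebraMap r => exact ⟨r, 0, by simp⟩
  | add a b _ _ ha hb =>
    obtain ⟨x, y, rfl⟩ := ha
    obtain ⟨z, w, rfl⟩ := hb
    exact ⟨x + z, y + w, by simp only [map_add]; ring⟩
  | mul a b _ _ ha hb =>
    obtain ⟨x, y, rfl⟩ := ha
    obtain ⟨z, w, rfl⟩ := hb
    refine ⟨x * z - y * w, x * w + y * z, ?_⟩
    simp only [map_add, map_sub, map_mul]
    linear_combination (algebraMap K (AlgebraicClosure K) y * algebraMap K _ w) * hi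

/-- If `t` is a root of `X ^ 2 - c X - 1`, then every power of `t` is of the form `x + y t`. -/
theorem exists_pow_eq_add_mul {t : AlgebraicClosure K} {c : K}
    (ht : t ^ 2 = algebraMap K _ c * t + 1) (n : ℕ) :
    ∃ x y : K, t ^ n = algebraMap K _ x + algebraMap K _ y * t := by
  induction n with
  | zero => exact ⟨1, 0, by simp⟩
  | succ n ih =>
    obtain ⟨x, y, h⟩ := ih
    refine ⟨y, x + y * c, ?_⟩
    rw [pow_succ, h]
    simp only [map_add, map_mul]
    linear_combination algebraMap K (AlgebraicClosure K) y * ht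

/-- A root of `X ^ 2 - c X - 1` having a power `i ∉ K` lies in `K(i)`. -/
theorem mem_adjoin_pow {t : AlgebraicClosure K} {c : K}
    (ht : t ^ 2 = algebraMap K _ c * t + 1) (n : ℕ) (hn : ¬InK K (t ^ n)) :
    t ∈ adjoin K {t ^ n} := by
  obtain ⟨x, y, h⟩ := exists_pow_eq_add_mul ht n
  have hy : algebraMap K (AlgebraicClosure K) y ≠ 0 := fun hy => hn ⟨x, by rw [h, hy]; ring⟩
  have key : t = (t ^ n - algebraMap K _ x) / algebraMap K _ y := by
    rw [h]
    field_simp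
    ring
  have hmem := div_mem (sub_mem (mem_adjoin_simple_self K (t ^ n)) (algebraMap_mem _ x))
    (algebraMap_mem (adjoin K {t ^ n}) y)
  rwa [← key] at hmem

open Polynomial in
/-- A square root of `-1` outside `K` is conjugate to its negative over `K`. -/
theorem exists_algEquiv_apply_eq_neg {i : AlgebraicClosure K} (hi : i ^ 2 = -1)
    (hK : ¬InK K i) :
    ∃ σ : AlgebraicClosure K ≃ₐ[K] AlgebraicClosure K, σ i = -i := by
  have hdeg : (X ^ 2 + C 1 : K[X]).natDegree = 2 := natDegree_X_pow_add_C
  have hmonic : (X ^ 2 + C 1 : K[X]).Monic := monic_X_pow_add_C 1 two_ne_zero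
  have hirr : Irreducible (X ^ 2 + C 1 : K[X]) := by
    rw [hmonic.irreducible_iff_roots_eq_zero_of_degree_le_three hdeg.ge (by omega)]
    refine Multiset.eq_zero_of_forall_notMem fun x hx => ?_
    have hx : x ^ 2 + 1 = 0 := by simpa using ((mem_roots hmonic.ne_zero).1 hx)
    have hx' : algebraMap K (AlgebraicClosure K) x ^ 2 + 1 = 0 := by
      rw [← map_pow, ← map_one (algebraMap K (AlgebraicClosure K)), ← map_add, hx, map_zero]
    have hmul : (i - algebraMap K _ x) * (i + algebraMap K _ x) = 0 := by
      linear_combination hi - hx'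
    rcases mul_eq_zero.1 hmul with h | h
    · exact hK ⟨x, (sub_eq_zero.1 h).symm⟩
    · exact hK ⟨-x, by rw [map_neg]; exact (eq_neg_of_add_eq_zero_left h).symm⟩
  have hmin : X ^ 2 + C 1 = minpoly K i :=
    minpoly.eq_of_irreducible_of_monic hirr (by simp [hi]) hmonic
  refine minpoly.exists_algEquiv_of_root' (Algebra.IsAlgebraic.isAlgebraic _) ?_
  rw [← hmin]
  simp [hi]

/-- If `σ` restricts to the nontrivial automorphism of `K(i) / K` and sends `u ^ 2` to the negative
of its inverse, then `u` is not in `K(i)`. -/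
theorem notMem_adjoin_of_conj_sq {i u : AlgebraicClosure K} (h2 : (2 : K) ≠ 0)
    (hi : i ^ 2 = -1) {σ : AlgebraicClosure K ≃ₐ[K] AlgebraicClosure K} (hσ : σ i = -i)
    (hu : u ≠ 0) (hσu : σ (u ^ 2) = -(u ^ 2)⁻¹) : u ∉ adjoin K {i} := by
  intro hmem
  obtain ⟨x, y, hxy⟩ := exists_add_mul_of_mem_adjoin hi hmem
  have hinv : σ (σ u) = u := by
    rw [hxy]
    simp [hσ]
  have hsq : (σ u * u) ^ 2 = i ^ 2 := by
    rw [mul_pow, ← map_pow, hσu, hi]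
    field_simp
  have hfix : σ (σ u * u) = σ u * u := by rw [map_mul, hinv, mul_comm]
  have hi0 : i ≠ 0 := by rintro rfl; simp at hi
  have h2' : (2 : AlgebraicClosure K) ≠ 0 := by
    rw [← map_ofNat (algebraMap K (AlgebraicClosure K)) 2]
    exact (map_ne_zero _).2 h2
  have hne : i * 2 ≠ 0 := mul_ne_zero hi0 h2'
  rcases sq_eq_sq_iff_eq_or_eq_neg.1 hsq with h | h
  · rw [h, hσ] at hfix
    exact hne (by linear_combination -hfix)
  · rw [h, map_neg, hσ] at hfix
    exact hne (by linear_combination hfix)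

end

/-- If no primitive `2 ^ (m + 1)`-th root of unity lies in the submonoid `S`, then
every `2`-power root of unity in `S` is a `2 ^ m`-th root of unity. -/
theorem pow_two_pow_eq_one_of_notMem {M : Type*} [CommMonoid M] (S : Submonoid M) {m : ℕ}
    (hS : ∀ ξ ∈ S, ¬IsPrimitiveRoot ξ (2 ^ (m + 1))) {ζ : M} (hζ : ζ ∈ S) {s : ℕ} (hs : m ≤ s)
    (h : ζ ^ 2 ^ s = 1) : ζ ^ 2 ^ m = 1 := by
  induction s, hs using Nat.le_induction with
  | base => exact h
  | succ s hs ih =>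
    refine ih (by_contra fun hne => hS _ (pow_mem hζ (2 ^ (s - m))) ?_)
    have hord : orderOf (ζ ^ 2 ^ (s - m)) = 2 ^ (m + 1) := by
      apply orderOf_eq_prime_pow
      · rwa [← pow_mul, ← pow_add, Nat.sub_add_cancel hs]
      · rwa [← pow_mul, ← pow_add, ← add_assoc, Nat.sub_add_cancel hs]
    rw [← hord]
    exact IsPrimitiveRoot.orderOf _

/-- If `σ t = -t⁻¹` with `t` a primitive `2 ^ m`-th root of unity, `m ≥ 3`, then a power `ζ` of `t`
with `ζ * σ ζ = 1` is of the form `η / σ η`, with `η` a power of `t`. -/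
theorem exists_pow_conj_mul_eq {F : Type*} [Field F] (h2 : (2 : F) ≠ 0) {σ : F ≃+* F} {t : F}
    {m : ℕ} (hm : 3 ≤ m) (ht : t ≠ 0) (ht' : t ^ 2 ^ (m - 1) = -1) (hσ : σ t = -t⁻¹) {k : ℕ}
    (hk : t ^ k * σ (t ^ k) = 1) : ∃ l : ℕ, σ (t ^ l) * t ^ k = t ^ l := by
  have hk2 : Even k := by
    by_contra hodd
    rw [map_pow, hσ, ← mul_pow, mul_neg, mul_inv_cancel₀ ht,
      (Nat.not_even_iff_odd.1 hodd).neg_one_pow] at hk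
    exact h2 (by linear_combination -hk)
  obtain ⟨j, rfl⟩ := hk2
  rcases Nat.even_or_odd j with hj | hj
  · refine ⟨j, ?_⟩
    rw [map_pow, hσ, hj.neg_pow, inv_pow, pow_add]
    field_simp
  · have hl : Odd (j + 2 ^ (m - 2)) :=
      hj.add_even ((Nat.even_pow.2 ⟨even_two, by omega⟩))
    refine ⟨j + 2 ^ (m - 2), ?_⟩
    have hsq : (t ^ 2 ^ (m - 2)) ^ 2 = -1 := by
      rw [← pow_mul, ← pow_succ, ← ht']
      congr 2
      omega
    rw [map_pow, hσ, hl.neg_pow, inv_pow, pow_add, pow_add]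
    field_simp
    rw [hsq]

/-- Lemma 3, case 5): if `K` is of type E with constant `m` and `s ≥ m`, then
`K_s = K*^{2^s}`. -/
theorem stmt_10 (K : Type*) [Field K] (h2 : (2 : K) ≠ 0)
    (ε : ℕ → AlgebraicClosure K)
    (hprim : ∀ n : ℕ, IsPrimitiveRoot (ε n) (2 ^ n))
    (hcomp : ∀ n : ℕ, ε (n + 1) ^ 2 = ε n)
    (m : ℕ) (hE : TypeEc K ε m) (s : ℕ) (hs : m ≤ s) :
    ∀ a : K, a ≠ 0 → (MemKs K ε s a ↔ ∃ b : K, b ≠ 0 ∧ a = b ^ 2 ^ s) := by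
  intro a ha
  have h2' : (2 : AlgebraicClosure K) ≠ 0 := by
    rw [← map_ofNat (algebraMap K (AlgebraicClosure K)) 2]
    exact (map_ne_zero _).2 h2
  obtain ⟨hK, hm, c, hc⟩ := hE
  have h_pow : ∀ n k : ℕ, ε (n + k) ^ 2 ^ k = ε n := by
    intro n k
    induction k with
    | zero => simp
    | succ k ih => rw [pow_succ', pow_mul, ← add_assoc, hcomp, ih]
  have hε1 : ε 1 = -1 := by
    have := hprim 1
    rw [pow_one] at this
    exact this.eq_neg_one_of_two_right
  have hi : ε 2 ^ 2 = -1 := (hcomp 1).trans hε1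
  have ht0 : ε m ≠ 0 := (hprim m).ne_zero (by positivity)
  have hti : ε m ^ 2 ^ (m - 2) = ε 2 := by
    have := h_pow 2 (m - 2)
    rwa [Nat.add_sub_cancel' (by omega)] at this
  have ht1 : ε m ^ 2 ^ (m - 1) = -1 := by
    have := h_pow 1 (m - 1)
    rwa [Nat.add_sub_cancel' (by omega), hε1] at this
  have htq : ε m ^ 2 = algebraMap K _ c * ε m + 1 := by
    rw [hc]
    field_simp
    ring
  have htL : ε m ∈ adjoin K {ε 2} := by
    have := mem_adjoin_pow htq (2 ^ (m - 2)) (by rwa [hti])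
    rwa [hti] at this
  obtain ⟨σ, hσ⟩ := exists_algEquiv_apply_eq_neg hi hK
  have hi0 : ε 2 ≠ 0 := (hprim 2).ne_zero (by positivity)
  have hσt : σ (ε m) = -(ε m)⁻¹ := by
    have h := congrArg σ htq
    rw [map_pow, map_add, map_mul, AlgEquiv.commutes, map_one, hc] at h
    have hmul : (σ (ε m) - ε m) * (σ (ε m) + (ε m)⁻¹) = 0 := by
      linear_combination h - mul_inv_cancel₀ ht0
    rcases mul_eq_zero.1 hmul with h | h
    · have h' := congrArg σ hti
      rw [map_pow, sub_eq_zero.1 h, hti, hσ] at h'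
      exact absurd (by linear_combination h') (mul_ne_zero hi0 h2')
    · exact eq_neg_of_add_eq_zero_left h
  have hnot : ε (m + 1) ∉ adjoin K {ε 2} :=
    notMem_adjoin_of_conj_sq h2 hi hσ ((hprim _).ne_zero (by positivity))
      (by rw [hcomp, hσt])
  constructor
  · rintro ⟨α, hα, hα0, haα⟩
    obtain ⟨x, y, hxy⟩ := exists_add_mul_of_mem_adjoin hi hα
    have hσσ : σ (σ α) = α := by
      rw [hxy]
      simp [hσ]
    have hσα : σ α ∈ adjoin K {ε 2} := by
      rw [hxy, map_add, map_mul, AlgEquiv.commutes, AlgEquiv.commutes, hσ]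
      exact add_mem (algebraMap_mem _ x)
        (mul_mem (algebraMap_mem _ y) (neg_mem (mem_adjoin_simple_self K _)))
    have hσα0 : σ α ≠ 0 := (map_ne_zero σ).2 hα0
    have hζs : (σ α / α) ^ 2 ^ s = 1 := by
      rw [div_pow, ← map_pow, ← haα, AlgEquiv.commutes]
      exact div_self ((map_ne_zero _).2 ha)
    have hζm : (σ α / α) ^ 2 ^ m = 1 := by
      refine pow_two_pow_eq_one_of_notMem (adjoin K {ε 2}).toSubalgebra.toSubmonoid ?_
        (div_mem (S := IntermediateField K _) (H := adjoin K {ε 2}) hσα hα) hs hζs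
      intro ξ hξ hprimξ
      obtain ⟨k, -, hk⟩ := hprimξ.eq_pow_of_pow_eq_one (hprim (m + 1)).pow_eq_one
      exact hnot (hk ▸ pow_mem (S := adjoin K {ε 2}) hξ k)
    obtain ⟨k, -, hk⟩ := (hprim m).eq_pow_of_pow_eq_one hζm
    obtain ⟨l, hl⟩ := exists_pow_conj_mul_eq h2' (σ := σ.toRingEquiv) (k := k) hm ht0 ht1 hσt (by
      rw [hk]
      change σ α / α * σ (σ α / α) = 1
      rw [map_div₀, hσσ]
      field_simp)
    change σ (ε m ^ l) * _ = _ at hl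
    have hfix : σ (α * ε m ^ l) = α * ε m ^ l := by
      rw [map_mul]
      nth_rewrite 2 [← hl]
      rw [hk]
      field_simp
    obtain ⟨z, w, hzw⟩ := exists_add_mul_of_mem_adjoin hi (mul_mem hα (pow_mem htL l))
    have hw : algebraMap K (AlgebraicClosure K) w = 0 := by
      rw [hzw, map_add, map_mul, AlgEquiv.commutes, AlgEquiv.commutes, hσ] at hfix
      have : algebraMap K (AlgebraicClosure K) w * (ε 2 * 2) = 0 := by
        linear_combination -hfix
      exact (mul_eq_zero.1 this).resolve_right (mul_ne_zero hi0 h2')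
    have haz : a = z ^ 2 ^ s := by
      apply (algebraMap K (AlgebraicClosure K)).injective
      rw [hw, zero_mul, add_zero] at hzw
      have hone : (ε m ^ l) ^ 2 ^ s = 1 := by
        rw [← pow_mul, mul_comm, pow_mul,
          (hprim m).pow_eq_one_iff_dvd _ |>.2 (pow_dvd_pow 2 hs), one_pow]
      rw [map_pow, ← hzw, mul_pow, hone, mul_one, haα]
    refine ⟨z, ?_, haz⟩
    rintro rfl
    exact ha (by rw [haz, zero_pow (by positivity)])
  · rintro ⟨b, hb, rfl⟩
    exact ⟨algebraMap K _ b, algebraMap_mem _ b, (map_ne_zero _).2 hb, map_pow _ _ _⟩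
end
end

section
/- Suppose ε_2 ∈ K and that at least one of the following holds: (a) ε_l ∈ K for every natural number l (type A); (b) K is of type B with constant m and 0 ≤ s ≤ m. Let n ≥ 1, a ∈ K*, A = K[X]/(X^{2^n} − a) with ḡ the image of X, s = H_n(a), and a = b^{2^s} with b ∈ K*. Then ε_s ∈ K, and the minimal idempotents of A are exactly the 2^s elements e_i = (1/2^s)·Σ_{j=0}^{2^s−1} (b^{−1}·ε_s^{−i}·ḡ^{2^{n−s}})^j for i = 0, 1, …, 2^s − 1. -/
noncomputable section

open Polynomial in
/-- Over a field in which `-1` is a square, `X ^ 2 ^ k - c` is irreducible whenever `c` is not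
a square. -/
theorem irreducible_X_pow_two_pow_sub_C {K : Type*} [Field K] {ι c : K} (hι : ι ^ 2 = -1)
    (hc : ∀ d : K, d ^ 2 ≠ c) (k : ℕ) : Irreducible (X ^ 2 ^ k - C c : K[X]) := by
  induction k generalizing K with
  | zero => simpa using irreducible_X_sub_C c
  | succ k ih =>
    rw [pow_succ]
    refine X_pow_mul_sub_C_irreducible (X_pow_sub_C_irreducible_of_prime Nat.prime_two hc) ?_
    intro E _ _ x hx
    have hint : IsIntegral K x := not_not.mp fun h ↦ by
      simpa only [degree_zero, degree_X_pow_sub_C Nat.two_pos, WithBot.natCast_ne_bot] using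
        congr_arg degree (hx.symm.trans (dif_neg h))
    refine ih (ι := algebraMap K _ ι) (by rw [← map_pow, hι, map_neg, map_one]) fun y hy ↦ ?_
    have hnorm := congr_arg (Algebra.norm K) hy
    rw [map_pow, ← IntermediateField.adjoin.powerBasis_gen hint,
      Algebra.PowerBasis.norm_gen_eq_coeff_zero_minpoly,
      IntermediateField.adjoin.powerBasis_gen, IntermediateField.minpoly_gen,
      IntermediateField.adjoin.powerBasis_dim, hx] at hnorm
    refine hc (ι * Algebra.norm K y) ?_
    rw [mul_pow, hι, hnorm, natDegree_X_pow_sub_C]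
    simp

/-- Let `e` be a complete family of nonzero orthogonal idempotents such that each product of some
`e i` with an idempotent is either `0` or `e i`. Then the minimal idempotents are the `e i`. -/
theorem isMinIdem_iff_of_sum_eq_one {A : Type*} [CommRing A] {N : ℕ} {e : ℕ → A}
    (hsum : ∑ i ∈ Finset.range N, e i = 1)
    (hne : ∀ i < N, e i ≠ 0) (hidem : ∀ i < N, e i * e i = e i)
    (hprim : ∀ i < N, ∀ x, x * x = x → e i * x = 0 ∨ e i * x = e i) (f : A) :
    IsMinIdem f ↔ ∃ i, i < N ∧ f = e i := by
  constructor
  · rintro ⟨hf0, hff, hf⟩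
    obtain ⟨i, hi, hif⟩ : ∃ i < N, e i * f ≠ 0 := by
      by_contra! h
      refine hf0 ?_
      rw [← one_mul f, ← hsum, Finset.sum_mul]
      exact Finset.sum_eq_zero fun i hi ↦ h i (Finset.mem_range.mp hi)
    have hif' : e i * f = e i := (hprim i hi f hff).resolve_left hif
    refine ⟨i, hi, by_contra fun h ↦ hf ⟨e i, f - e i, hne i hi, sub_ne_zero.mpr h, hidem i hi,
      ?_, ?_, by ring⟩⟩
    · linear_combination hff - 2 * hif' + hidem i hi
    · linear_combination hif' - hidem i hi
  · rintro ⟨i, hi, rfl⟩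
    refine ⟨hne i hi, hidem i hi, ?_⟩
    rintro ⟨x, y, hx0, hy0, hx, hy, hxy, h⟩
    have h1 : e i * x = x := by rw [h]; linear_combination hx + hxy
    rcases hprim i hi x hx with h2 | h2
    · exact hx0 (h1.symm.trans h2)
    · exact hy0 (by linear_combination h1 - h2 - h)

/-- An element of finite order `N` is fixed by its averaging element. -/
theorem mul_geom_sum_of_pow_eq_one {A : Type*} [CommRing A] {N : ℕ} {v : A} (hv : v ^ N = 1) :
    v * ∑ j ∈ Finset.range N, v ^ j = ∑ j ∈ Finset.range N, v ^ j := by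
  have := mul_geom_sum v N
  rw [hv] at this
  linear_combination this

/-- The averages of the powers of `ζ⁻¹ ^ i * u`, over all `i`, sum to one. -/
theorem sum_geom_sum_eq_one {K A : Type*} [Field K] [CommRing A] (φ : K →+* A) {N : ℕ} {ζ : K}
    (hζ : IsPrimitiveRoot ζ N) (hN : (N : K) ≠ 0) (u : A) :
    ∑ i ∈ Finset.range N,
      φ (1 / N) * ∑ j ∈ Finset.range N, (φ (ζ⁻¹ ^ i) * u) ^ j = 1 := by
  have hN0 : 0 < N := Nat.pos_of_ne_zero fun h ↦ hN (by simp [h])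
  have key : ∀ j ∈ Finset.range N, j ≠ 0 →
      ∑ i ∈ Finset.range N, (φ (ζ⁻¹ ^ i) * u) ^ j = 0 := fun j hj hj0 ↦ by
    have hz : ζ⁻¹ ^ j ≠ 1 :=
      hζ.inv.pow_ne_one_of_pos_of_lt hj0 (Finset.mem_range.mp hj)
    have hgeom : ∑ i ∈ Finset.range N, (ζ⁻¹ ^ j) ^ i = 0 := by
      have := mul_geom_sum (ζ⁻¹ ^ j) N
      rw [← pow_mul, mul_comm j N, pow_mul, hζ.inv.pow_eq_one, one_pow, sub_self] at this
      exact (mul_eq_zero.mp this).resolve_left (sub_ne_zero.mpr hz)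
    calc ∑ i ∈ Finset.range N, (φ (ζ⁻¹ ^ i) * u) ^ j
        = φ (∑ i ∈ Finset.range N, (ζ⁻¹ ^ j) ^ i) * u ^ j := by
          rw [map_sum, Finset.sum_mul]
          refine Finset.sum_congr rfl fun i _ ↦ ?_
          rw [mul_pow, ← map_pow, ← pow_mul, ← pow_mul, mul_comm i j]
      _ = 0 := by rw [hgeom, map_zero, zero_mul]
  rw [← Finset.mul_sum, Finset.sum_comm, Finset.sum_eq_single 0 key
    (fun h ↦ absurd (Finset.mem_range.mpr hN0) h)]
  simp only [pow_zero, Finset.sum_const, Finset.card_range, nsmul_eq_mul, mul_one]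
  rw [← map_natCast φ N, ← map_mul, one_div, inv_mul_cancel₀ hN, map_one]

open Polynomial in
/-- If an irreducible polynomial `P` satisfies `e * P(g) = 0` in `K[X] / (f)`, then
`e` times an idempotent is `0` or `e`. -/
theorem AdjoinRoot.mul_idem_eq_zero_or {K : Type*} [Field K] {f P : K[X]} (hP : Irreducible P)
    {e : AdjoinRoot f} (he : e * AdjoinRoot.mk f P = 0) {x : AdjoinRoot f} (hx : x * x = x) :
    e * x = 0 ∨ e * x = e := by
  obtain ⟨p, rfl⟩ := AdjoinRoot.mk_surjective x
  rcases (EuclideanDomain.dvd_or_coprime P p hP) with ⟨q, rfl⟩ | ⟨α, β, h⟩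
  · left
    rw [map_mul, ← mul_assoc, he, zero_mul]
  · right
    have h1 := congr_arg (AdjoinRoot.mk f) h
    simp only [map_add, map_mul, map_one] at h1
    linear_combination -(e * AdjoinRoot.mk f p - e) * h1 +
      (AdjoinRoot.mk f α * AdjoinRoot.mk f p - AdjoinRoot.mk f α) * he +
      e * AdjoinRoot.mk f β * hx

/-- Theorem 2, case 1): `ε₂ ∈ K` and either `K` is of type A, or of type B with
constant `m` and `s ≤ m`.  Then `ε_s ∈ K` and the minimal idempotents of
`A = K[X]/(X^{2^n} - a)` are exactly
`e_i = (1/2^s)·Σ_j (b⁻¹·ε_s⁻ⁱ·ḡ^{2^{n-s}})^j`, `i = 0, …, 2^s - 1`. -/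
theorem stmt_13 (K : Type*) [Field K] (h2 : (2 : K) ≠ 0)
    (ε : ℕ → AlgebraicClosure K)
    (hprim : ∀ n : ℕ, IsPrimitiveRoot (ε n) (2 ^ n))
    (hcomp : ∀ n : ℕ, ε (n + 1) ^ 2 = ε n)
    (hε2 : InK K (ε 2))
    (n : ℕ) (hn : 1 ≤ n) (a : K) (ha : a ≠ 0)
    -- `s = H_n(a)`:
    (s : ℕ) (hsn : s ≤ n) (hmem : MemKs K ε s a)
    (hmax : ∀ t : ℕ, t ≤ n → MemKs K ε t a → t ≤ s)
    (hcase : TypeA K ε ∨ ∃ m : ℕ, TypeBc K ε m ∧ s ≤ m)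
    (b : K) (hb : b ≠ 0) (hab : a = b ^ 2 ^ s)
    -- `ḡ` is the image of `X` in `A = K[X]/(X^{2^n} - a)`:
    (g : AdjoinRoot (Polynomial.X ^ 2 ^ n - Polynomial.C a))
    (hg : g = AdjoinRoot.root (Polynomial.X ^ 2 ^ n - Polynomial.C a))
    (φ : K →+* AdjoinRoot (Polynomial.X ^ 2 ^ n - Polynomial.C a))
    (hφ : φ = algebraMap K (AdjoinRoot (Polynomial.X ^ 2 ^ n - Polynomial.C a))) :
    ∃ w : K, algebraMap K (AlgebraicClosure K) w = ε s ∧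
      ∀ e : AdjoinRoot (Polynomial.X ^ 2 ^ n - Polynomial.C a),
        IsMinIdem e ↔ ∃ i : ℕ, i < 2 ^ s ∧
          e = φ (1 / 2 ^ s) *
            ∑ j ∈ Finset.range (2 ^ s), (φ (b⁻¹ * w⁻¹ ^ i) * g ^ 2 ^ (n - s)) ^ j := by
  have hεs : InK K (ε s) := by
    rcases hcase with h | ⟨m, ⟨-, -, ⟨z, hz⟩, -⟩, hsm⟩
    · exact h.2 s
    · have hpow : ∀ d, ε (s + d) ^ 2 ^ d = ε s := fun d ↦ by
        induction d with
        | zero => simp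
        | succ d ih => rw [← add_assoc, pow_succ', pow_mul, hcomp, ih]
      refine ⟨z ^ 2 ^ (m - s), ?_⟩
      rw [map_pow, hz, ← hpow (m - s), Nat.add_sub_cancel' hsm]
  obtain ⟨w, hw⟩ := hεs
  obtain ⟨ι, hι⟩ := hε2
  have hinj := (algebraMap K (AlgebraicClosure K)).injective
  have hι2 : ι ^ 2 = -1 := by
    refine hinj ?_
    have h1 : IsPrimitiveRoot (ε 1) 2 := by simpa using hprim 1
    rw [map_pow, hι, hcomp, h1.eq_neg_one_of_two_right, map_neg, map_one]
  have hwprim : IsPrimitiveRoot w (2 ^ s) :=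
    IsPrimitiveRoot.of_map_of_injective (f := algebraMap K (AlgebraicClosure K))
      (hw ▸ hprim s) hinj
  have hw0 : w ≠ 0 := hwprim.ne_zero (by positivity)
  have hN : ((2 ^ s : ℕ) : K) ≠ 0 := by push_cast; exact pow_ne_zero _ h2
  have hirr : ∀ i, Irreducible (Polynomial.X ^ 2 ^ (n - s) - Polynomial.C (b * w ^ i)) := fun i ↦ by
    rcases hsn.eq_or_lt with rfl | hlt
    · simpa using Polynomial.irreducible_X_sub_C (b * w ^ i)
    · refine irreducible_X_pow_two_pow_sub_C hι2 (fun d hd ↦ ?_) _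
      have had : a = d ^ 2 ^ (s + 1) := by
        rw [pow_succ', pow_mul, hd, mul_pow, ← pow_mul, mul_comm i, pow_mul, hwprim.pow_eq_one,
          one_pow, mul_one, hab]
      have := hmax (s + 1) hlt ⟨algebraMap K _ d, IntermediateField.algebraMap_mem _ d, ?_,
        by rw [had, map_pow]⟩
      · omega
      · rintro h0
        rw [map_eq_zero] at h0
        exact ha (by rw [had, h0, zero_pow (by positivity)])
  have hgpow : g ^ 2 ^ n = φ a := by
    have := AdjoinRoot.mk_self (f := Polynomial.X ^ 2 ^ n - Polynomial.C a)
    rw [map_sub, map_pow, AdjoinRoot.mk_X, AdjoinRoot.mk_C, sub_eq_zero] at this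
    rw [hg, hφ, AdjoinRoot.algebraMap_eq, this]
  set u := φ b⁻¹ * g ^ 2 ^ (n - s) with hu
  have hvu : ∀ i, φ (b⁻¹ * w⁻¹ ^ i) * g ^ 2 ^ (n - s) = φ (w⁻¹ ^ i) * u := fun i ↦ by
    rw [hu, map_mul]; ring
  have hupow : u ^ 2 ^ s = 1 := by
    rw [hu, mul_pow, ← pow_mul, ← pow_add, Nat.sub_add_cancel hsn, hgpow, ← map_pow, ← map_mul,
      show b⁻¹ ^ 2 ^ s * a = 1 by rw [hab, ← mul_pow, inv_mul_cancel₀ hb, one_pow], map_one]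
  have hvpow : ∀ i, (φ (w⁻¹ ^ i) * u) ^ 2 ^ s = 1 := fun i ↦ by
    rw [mul_pow, hupow, ← map_pow, ← pow_mul, mul_comm i, pow_mul, hwprim.inv.pow_eq_one, one_pow,
      map_one, mul_one]
  set e : ℕ → AdjoinRoot (Polynomial.X ^ 2 ^ n - Polynomial.C a) := fun i ↦
    φ (1 / 2 ^ s) * ∑ j ∈ Finset.range (2 ^ s), (φ (w⁻¹ ^ i) * u) ^ j with he
  have hue : ∀ i, u * e i = φ (w ^ i) * e i := fun i ↦ by
    have h1 := mul_geom_sum_of_pow_eq_one (hvpow i)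
    have h3 : φ (w ^ i) * φ (w⁻¹ ^ i) = 1 := by
      rw [← map_mul, ← mul_pow, mul_inv_cancel₀ hw0, one_pow, map_one]
    simp only [he]
    linear_combination φ (w ^ i) * φ (1 / 2 ^ s) * h1 -
      u * φ (1 / 2 ^ s) * (∑ j ∈ Finset.range (2 ^ s), (φ (w⁻¹ ^ i) * u) ^ j) * h3
  have hsum : ∑ i ∈ Finset.range (2 ^ s), e i = 1 := by
    have := sum_geom_sum_eq_one φ hwprim hN u
    push_cast at this
    exact this
  have hne : ∀ i, e i ≠ 0 := fun i h0 ↦ by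
    obtain ⟨z, hz⟩ := IsAlgClosed.exists_pow_nat_eq
      (algebraMap K (AlgebraicClosure K) (b * w ^ i)) (show 0 < 2 ^ (n - s) by positivity)
    have hza : z ^ 2 ^ n = algebraMap K (AlgebraicClosure K) a := by
      rw [← Nat.sub_add_cancel hsn, pow_add, pow_mul, hz, ← map_pow, mul_pow, ← pow_mul,
        mul_comm i, pow_mul, hwprim.pow_eq_one, one_pow, mul_one, hab]
    let ψ : AdjoinRoot (Polynomial.X ^ 2 ^ n - Polynomial.C a) →+* AlgebraicClosure K :=
      AdjoinRoot.lift (algebraMap K (AlgebraicClosure K)) z (by simp [hza])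
    have hψφ : ∀ x, ψ (φ x) = algebraMap K _ x := fun x ↦ by
      rw [hφ]; exact AdjoinRoot.lift_of _
    have hψg : ψ g = z := by rw [hg]; exact AdjoinRoot.lift_root _
    have hψv : ψ (φ (w⁻¹ ^ i) * u) = 1 := by
      rw [hu, map_mul, map_mul, map_pow ψ g, hψφ, hψφ, hψg, hz, ← map_mul, ← map_mul,
        show w⁻¹ ^ i * (b⁻¹ * (b * w ^ i)) = 1 by
          rw [inv_mul_cancel_left₀ hb, ← mul_pow, inv_mul_cancel₀ hw0, one_pow], map_one]
    have hψe : ψ (e i) = 1 := by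
      rw [he, map_mul, hψφ, map_sum]
      simp only [map_pow ψ, hψv, one_pow, Finset.sum_const, Finset.card_range, nsmul_eq_mul,
        mul_one]
      rw [← map_natCast (algebraMap K (AlgebraicClosure K)), ← map_mul]
      rw [show 1 / 2 ^ s * ((2 ^ s : ℕ) : K) = 1 by
          push_cast
          exact one_div_mul_cancel (pow_ne_zero _ h2), map_one]
    rw [h0, map_zero] at hψe
    exact zero_ne_one hψe
  have horth : ∀ i < 2 ^ s, ∀ k < 2 ^ s, i ≠ k → e i * e k = 0 := fun i hi k hk hik ↦ by
    have hwik : w ^ i - w ^ k ≠ 0 := sub_ne_zero.mpr fun h ↦ hik (hwprim.pow_inj hi hk h)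
    have h1 : φ (w ^ i - w ^ k) * (e i * e k) = 0 := by
      rw [map_sub]
      linear_combination e i * hue k - e k * hue i
    rw [← one_mul (e i * e k), ← map_one φ, ← inv_mul_cancel₀ hwik, map_mul, mul_assoc, h1,
      mul_zero]
  have hidem : ∀ i < 2 ^ s, e i * e i = e i := fun i hi ↦ by
    conv_rhs => rw [← mul_one (e i), ← hsum, Finset.mul_sum]
    rw [Finset.sum_eq_single i
      (fun k hk hki ↦ horth i hi k (Finset.mem_range.mp hk) hki.symm)
      (fun h ↦ absurd (Finset.mem_range.mpr hi) h)]
  have hkill : ∀ i, e i * AdjoinRoot.mk (Polynomial.X ^ 2 ^ n - Polynomial.C a)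
      (Polynomial.X ^ 2 ^ (n - s) - Polynomial.C (b * w ^ i)) = 0 := fun i ↦ by
    have h1 : AdjoinRoot.mk (Polynomial.X ^ 2 ^ n - Polynomial.C a) (Polynomial.X ^ 2 ^ (n - s) - Polynomial.C (b * w ^ i)) =
        g ^ 2 ^ (n - s) - φ b * φ (w ^ i) := by
      rw [← map_mul, hg, hφ]
      simp
    have h3 : φ b * φ b⁻¹ = 1 := by rw [← map_mul, mul_inv_cancel₀ hb, map_one]
    rw [h1]
    linear_combination φ b * hue i - e i * g ^ 2 ^ (n - s) * h3 + e i * φ b * hu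
  refine ⟨w, hw, fun f ↦ ?_⟩
  simp only [hvu]
  exact isMinIdem_iff_of_sum_eq_one hsum (fun i _ ↦ hne i) hidem
    (fun i _ x hx ↦ AdjoinRoot.mul_idem_eq_zero_or (hirr i) (hkill i) hx) f
end
end
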